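/- arXiv:2309.07700 — 12 statements merged into one kernel-verified Lean document; each statement's English description precedes it below -/
import Mathlib

section
/- Let n ≥ 2 and let σ be the 2×n matrix with first row (n, n-1, ..., 2, 1) and second row (n+1, n+2, ..., 2n-1, 2n). Then for every real 2×n matrix A, every σ-arrangement of A is supmodular. -/
/-- A real `m × n` matrix `A` is *supmodular* if for all indices `i < r` and `j < s`,
we have `A i j + A r s ≥ A i s + A r j`. -/
def Supmodular {m n : ℕ} (A : Matrix (Fin m) (Fin n) ℝ) : Prop :=
  ∀ (i r : Fin m) (j s : Fin n), i < r → j < s → A i j + A r s ≥ A i s + A r j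

/-- An `m × n` matrix `σ` whose entries form a permutation of `1, 2, ..., m*n`. -/
def IsPermMatrix {m n : ℕ} (σ : Matrix (Fin m) (Fin n) ℕ) : Prop :=
  Function.Injective (fun p : Fin m × Fin n => σ p.1 p.2) ∧
  ∀ p : Fin m × Fin n, 1 ≤ σ p.1 p.2 ∧ σ p.1 p.2 ≤ m * n

/-- `B` is a `σ`-arrangement of `A` if `B` is obtained from `A` by a bijection `π` of the
index set, and entries of `B` are ordered consistently with `σ`:
`σ p < σ q` implies `B p ≤ B q`. -/
def IsArrangement {m n : ℕ} (σ : Matrix (Fin m) (Fin n) ℕ)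
    (A B : Matrix (Fin m) (Fin n) ℝ) : Prop :=
  ∃ π : (Fin m × Fin n) ≃ (Fin m × Fin n),
    (∀ p : Fin m × Fin n, B p.1 p.2 = A (π p).1 (π p).2) ∧
    ∀ p q : Fin m × Fin n, σ p.1 p.2 < σ q.1 q.2 → B p.1 p.2 ≤ B q.1 q.2

/-- Among the four values `a = σ_{i,j}`, `b = σ_{i,j+1}`, `c = σ_{i+1,j}`, `d = σ_{i+1,j+1}`,
the maximum is `a` or `d`, and the minimum is `b` or `c`. -/
def Good4 {α : Type*} [LinearOrder α] (a b c d : α) : Prop :=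
  (max (max a b) (max c d) = a ∨ max (max a b) (max c d) = d) ∧
  (min (min a b) (min c d) = b ∨ min (min a b) (min c d) = c)

/-- `σ` is good on `(i, j)` (with `i + 1 < m`, `j + 1 < n`, zero-based indices). -/
def GoodOn {α : Type*} [LinearOrder α] {m n : ℕ} (σ : Matrix (Fin m) (Fin n) α)
    (i j : ℕ) (hi : i + 1 < m) (hj : j + 1 < n) : Prop :=
  Good4 (σ ⟨i, by omega⟩ ⟨j, by omega⟩) (σ ⟨i, by omega⟩ ⟨j + 1, hj⟩)
        (σ ⟨i + 1, hi⟩ ⟨j, by omega⟩) (σ ⟨i + 1, hi⟩ ⟨j + 1, hj⟩)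

/-- `A` is *permutable* if its entries can be permuted so that the resulting matrix
is supmodular. -/
def Permutable {m n : ℕ} (A : Matrix (Fin m) (Fin n) ℝ) : Prop :=
  ∃ π : (Fin m × Fin n) ≃ (Fin m × Fin n),
    Supmodular (Matrix.of fun i j => A (π (i, j)).1 (π (i, j)).2)

/-- For the 2×n matrix σ with first row (n, n-1, ..., 1) and second row (n+1, ..., 2n),
every σ-arrangement of any real 2×n matrix is supmodular. -/
theorem arrangement_supmodular_two_rows (n : ℕ) (hn : 2 ≤ n)
    (σ : Matrix (Fin 2) (Fin n) ℕ)
    (hσ : ∀ (i : Fin 2) (j : Fin n),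
      σ i j = if (i : ℕ) = 0 then n - (j : ℕ) else n + 1 + (j : ℕ))
    (A B : Matrix (Fin 2) (Fin n) ℝ) (hB : IsArrangement σ A B) :
    Supmodular B := by
  obtain ⟨π, -, h⟩ := hB
  intro i r j s hir hjs
  have hjs' : (j : ℕ) < s := hjs
  have hir' : (i : ℕ) < r := hir
  have h1 := h (i, s) (i, j) (by
    simp only [hσ]
    have := s.isLt
    split_ifs <;> omega)
  have h2 := h (r, j) (r, s) (by
    simp only [hσ]
    split_ifs <;> omega)
  simp only at h1 h2
  linarith
end

section
/- Let σ be the 3×3 matrix with rows (8,7,1), (4,5,3), (2,6,9). Then for every real 3×3 matrix A, every σ-arrangement of A is supmodular. -/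
/-- For σ with rows (8,7,1), (4,5,3), (2,6,9), every σ-arrangement of any real
3×3 matrix is supmodular. -/
theorem arrangement_supmodular_three_by_three
    (σ : Matrix (Fin 3) (Fin 3) ℕ) (hσ : σ = !![8, 7, 1; 4, 5, 3; 2, 6, 9])
    (A B : Matrix (Fin 3) (Fin 3) ℝ) (hB : IsArrangement σ A B) :
    Supmodular B := by
  subst hσ
  obtain ⟨π, -, h⟩ := hB
  have h12 : B 0 2 ≤ B 2 0 := h (0, 2) (2, 0) (by decide)
  have h23 : B 2 0 ≤ B 1 2 := h (2, 0) (1, 2) (by decide)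
  have h34 : B 1 2 ≤ B 1 0 := h (1, 2) (1, 0) (by decide)
  have h45 : B 1 0 ≤ B 1 1 := h (1, 0) (1, 1) (by decide)
  have h56 : B 1 1 ≤ B 2 1 := h (1, 1) (2, 1) (by decide)
  have h67 : B 2 1 ≤ B 0 1 := h (2, 1) (0, 1) (by decide)
  have h78 : B 0 1 ≤ B 0 0 := h (0, 1) (0, 0) (by decide)
  have h89 : B 0 0 ≤ B 2 2 := h (0, 0) (2, 2) (by decide)
  intro i r j s hir hjs
  fin_cases i <;> fin_cases r <;> first
    | exact absurd hir (by decide)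
    | (fin_cases j <;> fin_cases s <;> first
        | exact absurd hjs (by decide)
        | (simp only [Fin.zero_eta, Fin.mk_one, Fin.reduceFinMk]
           linarith))
end

section
/- Let σ be the 3×4 matrix with rows (9,8,7,3), (2,6,5,4), (1,10,11,12), and let τ be the 3×4 matrix with rows (12,3,2,1), (11,7,8,9), (4,5,6,10). Then for every real 3×4 matrix A, either every σ-arrangement of A is supmodular or every τ-arrangement of A is supmodular. -/
/-- The entries of a matrix, as a sequence. -/
def flatSeq (A : Matrix (Fin 3) (Fin 4) ℝ) : Fin 12 → ℝ :=
  fun k => A ((finProdFinEquiv (m := 3) (n := 4)).symm k).1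
    ((finProdFinEquiv (m := 3) (n := 4)).symm k).2

/-- The entries of a matrix in increasing order. -/
noncomputable def sortedSeq (A : Matrix (Fin 3) (Fin 4) ℝ) : Fin 12 → ℝ :=
  flatSeq A ∘ Tuple.sort (flatSeq A)

/-- The entries of an arrangement, read in the order of `σ`, are the sorted entries. -/
theorem arrangement_eq_sorted (σ : Matrix (Fin 3) (Fin 4) ℕ)
    (A B : Matrix (Fin 3) (Fin 4) ℝ) (e : Fin 12 → Fin 3 × Fin 4)
    (he : Function.Bijective e) (hσ : ∀ k, σ (e k).1 (e k).2 = k.val + 1)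
    (h : IsArrangement σ A B) (k : Fin 12) : B (e k).1 (e k).2 = sortedSeq A k := by
  obtain ⟨π, hB, hle⟩ := h
  let p : Equiv.Perm (Fin 12) :=
    ((Equiv.ofBijective e he).trans π).trans (finProdFinEquiv (m := 3) (n := 4))
  have hp : ∀ k, (flatSeq A ∘ p) k = B (e k).1 (e k).2 := by
    intro k
    rw [hB]
    simp only [flatSeq, p, Function.comp, Equiv.trans_apply, Equiv.ofBijective_apply]
    rw [Equiv.symm_apply_apply]
  have hm : Monotone (flatSeq A ∘ p) := by
    intro i j hij
    rw [hp, hp]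
    rcases hij.eq_or_lt with rfl | hlt
    · exact le_rfl
    · refine hle (e i) (e j) ?_
      rw [hσ, hσ]
      have : i.val < j.val := hlt
      omega
  have := Tuple.unique_monotone hm (Tuple.monotone_sort (flatSeq A))
  rw [← hp, this]
  rfl

/-- With σ having rows (9,8,7,3), (2,6,5,4), (1,10,11,12) and τ having rows
(12,3,2,1), (11,7,8,9), (4,5,6,10), for every real 3×4 matrix A either every
σ-arrangement of A is supmodular or every τ-arrangement of A is supmodular. -/
theorem arrangement_supmodular_three_by_four
    (σ τ : Matrix (Fin 3) (Fin 4) ℕ)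
    (hσ : σ = !![9, 8, 7, 3; 2, 6, 5, 4; 1, 10, 11, 12])
    (hτ : τ = !![12, 3, 2, 1; 11, 7, 8, 9; 4, 5, 6, 10])
    (A : Matrix (Fin 3) (Fin 4) ℝ) :
    (∀ B, IsArrangement σ A B → Supmodular B) ∨
    (∀ B, IsArrangement τ A B → Supmodular B) := by
  have hm : Monotone (sortedSeq A) := Tuple.monotone_sort (flatSeq A)
  have m0 : sortedSeq A 0 ≤ sortedSeq A 1 := hm (by decide)
  have m1 : sortedSeq A 1 ≤ sortedSeq A 2 := hm (by decide)
  have m2 : sortedSeq A 2 ≤ sortedSeq A 3 := hm (by decide)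
  have m3 : sortedSeq A 3 ≤ sortedSeq A 4 := hm (by decide)
  have m4 : sortedSeq A 4 ≤ sortedSeq A 5 := hm (by decide)
  have m5 : sortedSeq A 5 ≤ sortedSeq A 6 := hm (by decide)
  have m6 : sortedSeq A 6 ≤ sortedSeq A 7 := hm (by decide)
  have m7 : sortedSeq A 7 ≤ sortedSeq A 8 := hm (by decide)
  have m8 : sortedSeq A 8 ≤ sortedSeq A 9 := hm (by decide)
  have m9 : sortedSeq A 9 ≤ sortedSeq A 10 := hm (by decide)
  have m10 : sortedSeq A 10 ≤ sortedSeq A 11 := hm (by decide)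
  rcases le_total (sortedSeq A 5 - sortedSeq A 4) (sortedSeq A 7 - sortedSeq A 6) with hc | hc
  · left
    intro B hB
    have key := arrangement_eq_sorted _ A B ![(2, 0), (1, 0), (0, 3), (1, 3), (1, 2), (1, 1), (0, 2), (0, 1), (0, 0), (2, 1), (2, 2), (2, 3)]
      (by decide) (by rw [hσ]; decide) hB
    have k0 : B 2 0 = sortedSeq A 0 := key 0
    have k1 : B 1 0 = sortedSeq A 1 := key 1
    have k2 : B 0 3 = sortedSeq A 2 := key 2
    have k3 : B 1 3 = sortedSeq A 3 := key 3
    have k4 : B 1 2 = sortedSeq A 4 := key 4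
    have k5 : B 1 1 = sortedSeq A 5 := key 5
    have k6 : B 0 2 = sortedSeq A 6 := key 6
    have k7 : B 0 1 = sortedSeq A 7 := key 7
    have k8 : B 0 0 = sortedSeq A 8 := key 8
    have k9 : B 2 1 = sortedSeq A 9 := key 9
    have k10 : B 2 2 = sortedSeq A 10 := key 10
    have k11 : B 2 3 = sortedSeq A 11 := key 11
    intro i r j s hir hjs
    fin_cases i <;> fin_cases r <;> first | exact absurd hir (by decide) | skip
    all_goals fin_cases j <;> fin_cases s <;> first | exact absurd hjs (by decide) | skip
    all_goals simp only [Fin.zero_eta, Fin.mk_one, Fin.reduceFinMk, k0, k1, k2, k3, k4, k5, k6, k7, k8, k9, k10, k11]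
    all_goals linarith
  · right
    intro B hB
    have key := arrangement_eq_sorted _ A B ![(0, 3), (0, 2), (0, 1), (2, 0), (2, 1), (2, 2), (1, 1), (1, 2), (1, 3), (2, 3), (1, 0), (0, 0)]
      (by decide) (by rw [hτ]; decide) hB
    have k0 : B 0 3 = sortedSeq A 0 := key 0
    have k1 : B 0 2 = sortedSeq A 1 := key 1
    have k2 : B 0 1 = sortedSeq A 2 := key 2
    have k3 : B 2 0 = sortedSeq A 3 := key 3
    have k4 : B 2 1 = sortedSeq A 4 := key 4
    have k5 : B 2 2 = sortedSeq A 5 := key 5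
    have k6 : B 1 1 = sortedSeq A 6 := key 6
    have k7 : B 1 2 = sortedSeq A 7 := key 7
    have k8 : B 1 3 = sortedSeq A 8 := key 8
    have k9 : B 2 3 = sortedSeq A 9 := key 9
    have k10 : B 1 0 = sortedSeq A 10 := key 10
    have k11 : B 0 0 = sortedSeq A 11 := key 11
    intro i r j s hir hjs
    fin_cases i <;> fin_cases r <;> first | exact absurd hir (by decide) | skip
    all_goals fin_cases j <;> fin_cases s <;> first | exact absurd hjs (by decide) | skip
    all_goals simp only [Fin.zero_eta, Fin.mk_one, Fin.reduceFinMk, k0, k1, k2, k3, k4, k5, k6, k7, k8, k9, k10, k11]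
    all_goals linarith
end

section
/- Let σ be an m×n matrix whose entries form a permutation of 1, 2, ..., mn, and let 1 ≤ i < m and 1 ≤ j < n. If σ is good on (i,j), then for every real m×n matrix A and every σ-arrangement B of A, the inequality B_{i,j} + B_{i+1,j+1} ≥ B_{i,j+1} + B_{i+1,j} holds. -/
/-- If σ is good on (i,j), then every σ-arrangement B of every real m×n matrix A
satisfies B_{i,j} + B_{i+1,j+1} ≥ B_{i,j+1} + B_{i+1,j}. -/
theorem good_implies_ineq {m n : ℕ} (σ : Matrix (Fin m) (Fin n) ℕ)
    (hperm : IsPermMatrix σ) (i j : ℕ) (hi : i + 1 < m) (hj : j + 1 < n)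
    (hgood : GoodOn σ i j hi hj)
    (A B : Matrix (Fin m) (Fin n) ℝ) (hB : IsArrangement σ A B) :
    B ⟨i, by omega⟩ ⟨j, by omega⟩ + B ⟨i + 1, hi⟩ ⟨j + 1, hj⟩ ≥
      B ⟨i, by omega⟩ ⟨j + 1, hj⟩ + B ⟨i + 1, hi⟩ ⟨j, by omega⟩ := by
  obtain ⟨π, -, hlt⟩ := hB
  have hmono : ∀ p q : Fin m × Fin n, σ p.1 p.2 ≤ σ q.1 q.2 → B p.1 p.2 ≤ B q.1 q.2 := by
    intro p q h
    rcases h.lt_or_eq with h | h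
    · exact hlt p q h
    · rw [hperm.1 h]
  have i0 : i < m := by omega
  have j0 : j < n := by omega
  have hab := hmono (⟨i, i0⟩, ⟨j + 1, hj⟩) (⟨i, i0⟩, ⟨j, j0⟩)
  have hac := hmono (⟨i + 1, hi⟩, ⟨j, j0⟩) (⟨i, i0⟩, ⟨j, j0⟩)
  have hdb := hmono (⟨i, i0⟩, ⟨j + 1, hj⟩) (⟨i + 1, hi⟩, ⟨j + 1, hj⟩)
  have hdc := hmono (⟨i + 1, hi⟩, ⟨j, j0⟩) (⟨i + 1, hi⟩, ⟨j + 1, hj⟩)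
  unfold GoodOn Good4 at hgood
  dsimp only at hab hac hdb hdc
  obtain ⟨h1 | h1, h2 | h2⟩ := hgood
  · linarith [hac (by omega), hdb (by omega)]
  · linarith [hab (by omega), hdc (by omega)]
  · linarith [hab (by omega), hdc (by omega)]
  · linarith [hac (by omega), hdb (by omega)]
end

section
/- Let σ be an m×n matrix whose entries form a permutation of 1, 2, ..., mn, and let 1 ≤ i < m and 1 ≤ j < n. If σ is not good on (i,j), then there exists a real m×n matrix A and a σ-arrangement B of A such that B_{i,j} + B_{i+1,j+1} < B_{i,j+1} + B_{i+1,j}. -/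
/-- If four values are not good, some threshold function violates the inequality. -/
lemma exists_threshold (a b c d : ℕ) (h : ¬ Good4 a b c d) :
    ∃ t : ℕ, (if t ≤ a then (1 : ℝ) else 0) + (if t ≤ d then (1 : ℝ) else 0) <
      (if t ≤ b then (1 : ℝ) else 0) + (if t ≤ c then (1 : ℝ) else 0) := by
  unfold Good4 at h
  rw [not_and_or] at h
  rcases h with h | h
  · refine ⟨max (max a b) (max c d), ?_⟩
    have ha : ¬ max (max a b) (max c d) ≤ a := by omega
    have hd : ¬ max (max a b) (max c d) ≤ d := by omega
    have hbc : max (max a b) (max c d) ≤ b ∨ max (max a b) (max c d) ≤ c := by omega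
    rw [if_neg ha, if_neg hd]
    rcases hbc with hb | hc
    · rw [if_pos hb]; split_ifs <;> norm_num
    · rw [if_pos hc]; split_ifs <;> norm_num
  · refine ⟨min (min a b) (min c d) + 1, ?_⟩
    have hb : min (min a b) (min c d) + 1 ≤ b := by omega
    have hc : min (min a b) (min c d) + 1 ≤ c := by omega
    have had : ¬ min (min a b) (min c d) + 1 ≤ a ∨ ¬ min (min a b) (min c d) + 1 ≤ d := by omega
    rw [if_pos hb, if_pos hc]
    rcases had with ha | hd
    · rw [if_neg ha]; split_ifs <;> norm_num
    · rw [if_neg hd]; split_ifs <;> norm_num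

/-- If σ is not good on (i,j), then there is a real m×n matrix A and a σ-arrangement
B of A with B_{i,j} + B_{i+1,j+1} < B_{i,j+1} + B_{i+1,j}. -/
theorem not_good_implies_counterexample {m n : ℕ} (σ : Matrix (Fin m) (Fin n) ℕ)
    (hperm : IsPermMatrix σ) (i j : ℕ) (hi : i + 1 < m) (hj : j + 1 < n)
    (hbad : ¬ GoodOn σ i j hi hj) :
    ∃ (A B : Matrix (Fin m) (Fin n) ℝ), IsArrangement σ A B ∧
      B ⟨i, by omega⟩ ⟨j, by omega⟩ + B ⟨i + 1, hi⟩ ⟨j + 1, hj⟩ <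
        B ⟨i, by omega⟩ ⟨j + 1, hj⟩ + B ⟨i + 1, hi⟩ ⟨j, by omega⟩ := by
  obtain ⟨t, ht⟩ := exists_threshold _ _ _ _ hbad
  refine ⟨fun r s => if t ≤ σ r s then 1 else 0, fun r s => if t ≤ σ r s then 1 else 0,
    ⟨Equiv.refl _, fun p => rfl, fun p q hpq => ?_⟩, ht⟩
  dsimp only
  split_ifs with h1 h2
  · exact le_rfl
  · omega
  · norm_num
  · exact le_rfl
end

section
/- Let σ be an m×n matrix whose entries form a permutation of 1, 2, ..., mn. If σ is good on (i,j) for all 1 ≤ i < m and 1 ≤ j < n, then σ is universal, i.e., for every real m×n matrix A, every σ-arrangement of A is supmodular. -/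
/-- If σ is good on every (i,j), then σ is universal: every σ-arrangement of every
real m×n matrix is supmodular. -/
theorem good_everywhere_implies_universal {m n : ℕ} (σ : Matrix (Fin m) (Fin n) ℕ)
    (hperm : IsPermMatrix σ)
    (hgood : ∀ (i j : ℕ) (hi : i + 1 < m) (hj : j + 1 < n), GoodOn σ i j hi hj) :
    ∀ (A B : Matrix (Fin m) (Fin n) ℝ), IsArrangement σ A B → Supmodular B := by
  rintro A B ⟨π, -, hmono⟩
  have hle : ∀ i j r s, σ i j ≤ σ r s → B i j ≤ B r s := by
    intro i j r s h
    rcases h.lt_or_eq with h | h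
    · exact hmono (i, j) (r, s) h
    · have h' : (i, j) = (r, s) := hperm.1 h
      simp only [Prod.mk.injEq] at h'
      rw [h'.1, h'.2]
  have hloc : ∀ (i j : ℕ) (hi : i + 1 < m) (hj : j + 1 < n),
      B ⟨i, by omega⟩ ⟨j + 1, hj⟩ + B ⟨i + 1, hi⟩ ⟨j, by omega⟩ ≤
      B ⟨i, by omega⟩ ⟨j, by omega⟩ + B ⟨i + 1, hi⟩ ⟨j + 1, hj⟩ := by
    intro i j hi hj
    obtain ⟨h1, h2⟩ := hgood i j hi hj
    have hab := hle ⟨i, by omega⟩ ⟨j + 1, hj⟩ ⟨i, by omega⟩ ⟨j, by omega⟩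
    have hca := hle ⟨i + 1, hi⟩ ⟨j, by omega⟩ ⟨i, by omega⟩ ⟨j, by omega⟩
    have hbd := hle ⟨i, by omega⟩ ⟨j + 1, hj⟩ ⟨i + 1, hi⟩ ⟨j + 1, hj⟩
    have hcd := hle ⟨i + 1, hi⟩ ⟨j, by omega⟩ ⟨i + 1, hi⟩ ⟨j + 1, hj⟩
    rcases h1 with h1 | h1 <;> rcases h2 with h2 | h2
    · linarith [hca (by omega), hbd (by omega)]
    · linarith [hab (by omega), hcd (by omega)]
    · linarith [hcd (by omega), hab (by omega)]
    · linarith [hbd (by omega), hca (by omega)]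
  have hrow : ∀ (i : ℕ) (hi : i + 1 < m) (j s : ℕ) (hjs : j ≤ s) (hs : s < n),
      B ⟨i, by omega⟩ ⟨s, hs⟩ + B ⟨i + 1, hi⟩ ⟨j, by omega⟩ ≤
      B ⟨i, by omega⟩ ⟨j, by omega⟩ + B ⟨i + 1, hi⟩ ⟨s, hs⟩ := by
    intro i hi j s hjs
    induction s, hjs using Nat.le_induction with
    | base => intro hs; exact le_rfl
    | succ s hjs ih =>
      intro hs
      linarith [ih (by omega), hloc i s hi hs]
  have hall : ∀ (i r : ℕ) (hir : i ≤ r) (hr : r < m) (j s : ℕ) (hjs : j ≤ s) (hs : s < n),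
      B ⟨i, by omega⟩ ⟨s, hs⟩ + B ⟨r, hr⟩ ⟨j, by omega⟩ ≤
      B ⟨i, by omega⟩ ⟨j, by omega⟩ + B ⟨r, hr⟩ ⟨s, hs⟩ := by
    intro i r hir
    induction r, hir using Nat.le_induction with
    | base => intro hr j s hjs hs; linarith
    | succ r hir ih =>
      intro hr j s hjs hs
      linarith [ih (by omega) j s hjs hs, hrow r hr j s hjs hs]
  intro i r j s hir hjs
  exact hall i r (le_of_lt hir) r.2 j s (le_of_lt hjs) s.2
end

section
/- Let 1 ≤ m ≤ n. There exists a universal σ for m×n matrices (that is, an m×n matrix σ whose entries form a permutation of 1, 2, ..., mn such that for every real m×n matrix A, every σ-arrangement of A is supmodular) if and only if m = 1, or m = 2, or m = n = 3. -/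
/-- Universality forces one of the two dominance patterns on each minor. -/
lemma good_of_universal {m n : ℕ} (σ : Matrix (Fin m) (Fin n) ℕ) (hσ : IsPermMatrix σ)
    (h : ∀ (A B : Matrix (Fin m) (Fin n) ℝ), IsArrangement σ A B → Supmodular B)
    (i r : Fin m) (j s : Fin n) (hir : i < r) (hjs : j < s) :
    (σ i s < σ i j ∧ σ r j < σ r s) ∨ (σ r j < σ i j ∧ σ i s < σ r s) := by
  have key : ∀ t : ℕ, (if t ≤ σ i j then (1:ℝ) else 0) + (if t ≤ σ r s then (1:ℝ) else 0)
      ≥ (if t ≤ σ i s then (1:ℝ) else 0) + (if t ≤ σ r j then (1:ℝ) else 0) := by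
    intro t
    refine h (fun x y => if t ≤ σ x y then (1:ℝ) else 0)
      (fun x y => if t ≤ σ x y then (1:ℝ) else 0) ⟨Equiv.refl _, fun p => rfl, ?_⟩ i r j s hir hjs
    intro p q hpq
    dsimp only
    split_ifs <;> first | omega | norm_num
  have inj : ∀ x y x' y', σ x y = σ x' y' → x = x' ∧ y = y' := by
    intro x y x' y' e
    have := @hσ.1 (x, y) (x', y') e
    simpa using this
  have n1 : σ i j ≠ σ i s := fun e => hjs.ne (inj _ _ _ _ e).2
  have n2 : σ i j ≠ σ r j := fun e => hir.ne (inj _ _ _ _ e).1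
  have n3 : σ r s ≠ σ r j := fun e => hjs.ne' (inj _ _ _ _ e).2
  have n4 : σ r s ≠ σ i s := fun e => hir.ne' (inj _ _ _ _ e).1
  have k1 := key (σ i s)
  have k2 := key (σ r j)
  rw [if_pos le_rfl] at k1
  rw [if_pos (le_refl (σ r j))] at k2
  split_ifs at k1 k2 <;> first | omega | (exfalso; linarith)

lemma no_three_four {m n : ℕ} (hm : 3 ≤ m) (hn : 4 ≤ n)
    (σ : Matrix (Fin m) (Fin n) ℕ) (hσ : IsPermMatrix σ)
    (h : ∀ (A B : Matrix (Fin m) (Fin n) ℝ), IsArrangement σ A B → Supmodular B) : False := by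
  have g : ∀ (i j : ℕ) (hi : i + 1 < m) (hj : j + 1 < n), _ := fun i j hi hj =>
    good_of_universal σ hσ h ⟨i, by omega⟩ ⟨i + 1, hi⟩ ⟨j, by omega⟩ ⟨j + 1, hj⟩
      (Fin.mk_lt_mk.2 (by omega)) (Fin.mk_lt_mk.2 (by omega))
  have g00 := g 0 0 (by omega) (by omega)
  have g01 := g 0 1 (by omega) (by omega)
  have g02 := g 0 2 (by omega) (by omega)
  have g10 := g 1 0 (by omega) (by omega)
  have g11 := g 1 1 (by omega) (by omega)
  have g12 := g 1 2 (by omega) (by omega)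
  simp only [Nat.reduceAdd] at g00 g01 g02 g10 g11 g12
  omega

lemma exists_two (n : ℕ) : ∃ σ : Matrix (Fin 2) (Fin n) ℕ, IsPermMatrix σ ∧
      ∀ (A B : Matrix (Fin 2) (Fin n) ℝ), IsArrangement σ A B → Supmodular B := by
  refine ⟨fun i j => if i = 0 then n - j else n + j + 1, ⟨?_, ?_⟩, ?_⟩
  · rintro ⟨i, j⟩ ⟨i', j'⟩ e
    have := j.2
    have := j'.2
    fin_cases i <;> fin_cases i' <;> simp [Fin.ext_iff] at e ⊢ <;> omega
  · rintro ⟨i, j⟩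
    have := j.2
    fin_cases i <;> simp <;> omega
  · rintro A B ⟨π, -, hB⟩ i r j s hir hjs
    have hi : i = 0 := by omega
    have hr : r = 1 := by omega
    subst hi hr
    have h1 := hB (0, s) (0, j) (by simp; omega)
    have h2 := hB (1, j) (1, s) (by simp; omega)
    simp only at h1 h2
    linarith

lemma exists_one (n : ℕ) : ∃ σ : Matrix (Fin 1) (Fin n) ℕ, IsPermMatrix σ ∧
      ∀ (A B : Matrix (Fin 1) (Fin n) ℝ), IsArrangement σ A B → Supmodular B := by
  refine ⟨fun _ j => j + 1, ⟨?_, ?_⟩, ?_⟩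
  · rintro ⟨i, j⟩ ⟨i', j'⟩ e
    simp only [Prod.mk.injEq, Fin.ext_iff] at e ⊢
    omega
  · rintro ⟨i, j⟩
    have := j.2
    simp only
    omega
  · intro A B _ i r j s hir
    omega

lemma exists_three : ∃ σ : Matrix (Fin 3) (Fin 3) ℕ, IsPermMatrix σ ∧
      ∀ (A B : Matrix (Fin 3) (Fin 3) ℝ), IsArrangement σ A B → Supmodular B := by
  refine ⟨!![7, 2, 1; 6, 5, 8; 3, 4, 9], ⟨?_, ?_⟩, ?_⟩
  · unfold Function.Injective; decide
  · decide
  · rintro A B ⟨π, -, hB⟩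
    have gd : ∀ i r j s : Fin 3, i < r → j < s →
        B i j + B r s ≥ B i s + B r j := by
      have h : ∀ x y x' y' : Fin 3, (!![7, 2, 1; 6, 5, 8; 3, 4, 9] : Matrix (Fin 3) (Fin 3) ℕ) x y
          < (!![7, 2, 1; 6, 5, 8; 3, 4, 9] : Matrix (Fin 3) (Fin 3) ℕ) x' y' → B x y ≤ B x' y' :=
        fun x y x' y' => hB (x, y) (x', y')
      have d1 := h 1 0 0 0 (by decide)
      have d2 := h 0 1 1 1 (by decide)
      have d3 := h 0 2 0 1 (by decide)
      have d4 := h 1 1 1 2 (by decide)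
      have d5 := h 1 1 1 0 (by decide)
      have d6 := h 2 0 2 1 (by decide)
      have d7 := h 2 1 1 1 (by decide)
      have d8 := h 1 2 2 2 (by decide)
      intro i r j s hi hj
      have e1 : (i = 0 ∧ r = 1) ∨ (i = 0 ∧ r = 2) ∨ (i = 1 ∧ r = 2) := by omega
      have e2 : (j = 0 ∧ s = 1) ∨ (j = 0 ∧ s = 2) ∨ (j = 1 ∧ s = 2) := by omega
      rcases e1 with ⟨rfl, rfl⟩ | ⟨rfl, rfl⟩ | ⟨rfl, rfl⟩ <;>
      rcases e2 with ⟨rfl, rfl⟩ | ⟨rfl, rfl⟩ | ⟨rfl, rfl⟩ <;> linarith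
    exact gd

/-- For 1 ≤ m ≤ n, a universal σ for m×n matrices exists if and only if
m = 1, m = 2, or m = n = 3. -/
theorem universal_iff (m n : ℕ) (hm : 1 ≤ m) (hmn : m ≤ n) :
    (∃ σ : Matrix (Fin m) (Fin n) ℕ, IsPermMatrix σ ∧
      ∀ (A B : Matrix (Fin m) (Fin n) ℝ), IsArrangement σ A B → Supmodular B) ↔
    (m = 1 ∨ m = 2 ∨ (m = 3 ∧ n = 3)) := by
  constructor
  · rintro ⟨σ, hσ, h⟩
    by_contra hc
    exact no_three_four (by omega) (by omega) σ hσ h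
  · rintro (rfl | rfl | ⟨rfl, rfl⟩)
    · exact exists_one n
    · exact exists_two n
    · exact exists_three
end

section
/- Let 3 ≤ m ≤ n with n ≥ 4. Then there is no universal σ for m×n matrices; that is, for every m×n matrix σ whose entries form a permutation of 1, 2, ..., mn, there exists a real m×n matrix A and a σ-arrangement of A that is not supmodular. -/
/-- Bit masks (cell `(i, j)` is bit `4 * i + j`) of the 0/1 matrices of size `3 × 4` reachable
from the zero matrix by adding one 1 at a time through supmodular matrices. -/
def reach : List ℕ :=
  [0, 1, 2048, 3, 17, 2049, 2176, 3072, 7, 273, 2051, 2065, 2177, 2184, 3073, 3584, 15, 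
  2055, 2179, 2185, 2193, 2321, 3075, 3089, 3585, 3840, 2063, 2183, 2187, 2201, 2449, 3079, 
  3345, 3587, 3601, 3841, 2191, 2457, 3087, 3143, 3591, 3619, 3843, 3857, 3271, 3599, 3635, 
  3847, 3279, 3855, 3891]

/-- The cell value of a mask. -/
def cellBit (M : ℕ) (i j : ℕ) : Bool := M.testBit (4 * i + j)

/-- The mask is supmodular. -/
def maskOk (M : ℕ) : Bool :=
  [(0, 1), (0, 2), (1, 2)].all fun a : ℕ × ℕ =>
    [(0, 1), (0, 2), (0, 3), (1, 2), (1, 3), (2, 3)].all fun b : ℕ × ℕ =>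
      Nat.ble ((cellBit M a.1 b.2).toNat + (cellBit M a.2 b.1).toNat)
        ((cellBit M a.1 b.1).toNat + (cellBit M a.2 b.2).toNat)

theorem reach_step : ∀ M ∈ reach, ∀ i : Fin 3, ∀ j : Fin 4,
    maskOk (M ||| 2 ^ (4 * i.1 + j.1)) = true → (M ||| 2 ^ (4 * i.1 + j.1)) ∈ reach := by
  decide +kernel

theorem reach_not_full : ∀ M ∈ reach, ∃ i : Fin 3, ∃ j : Fin 4, cellBit M i j = false := by
  decide +kernel

theorem no_chain (f : Fin 3 → Fin 4 → ℕ)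
    (hinj : ∀ i j k l, f i j = f k l → i = k ∧ j = l)
    (hsup : ∀ t : ℕ, ∀ i r : Fin 3, ∀ j s : Fin 4, i < r → j < s →
      (decide (t ≤ f i s)).toNat + (decide (t ≤ f r j)).toNat ≤
        (decide (t ≤ f i j)).toNat + (decide (t ≤ f r s)).toNat)
    (N : ℕ) (hN : ∀ i j, f i j < N) : False := by
  have ok : ∀ t M, (∀ (i : Fin 3) (j : Fin 4), cellBit M i j = decide (t ≤ f i j)) →
      maskOk M = true := by
    intro t M h
    have h' : ∀ (i r : Fin 3) (j s : Fin 4), i < r → j < s →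
        Nat.ble ((cellBit M i s).toNat + (cellBit M r j).toNat)
        ((cellBit M i j).toNat + (cellBit M r s).toNat) = true := by
      intro i r j s hi hj
      rw [Nat.ble_eq, h, h, h, h]
      exact hsup t i r j s hi hj
    simp only [maskOk, List.all_cons, List.all_nil, Bool.and_true, Bool.and_eq_true]
    refine ⟨⟨?_, ?_, ?_, ?_, ?_, ?_⟩, ⟨?_, ?_, ?_, ?_, ?_, ?_⟩, ⟨?_, ?_, ?_, ?_, ?_, ?_⟩⟩
    · exact h' 0 1 0 1 (by decide) (by decide)
    · exact h' 0 1 0 2 (by decide) (by decide)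
    · exact h' 0 1 0 3 (by decide) (by decide)
    · exact h' 0 1 1 2 (by decide) (by decide)
    · exact h' 0 1 1 3 (by decide) (by decide)
    · exact h' 0 1 2 3 (by decide) (by decide)
    · exact h' 0 2 0 1 (by decide) (by decide)
    · exact h' 0 2 0 2 (by decide) (by decide)
    · exact h' 0 2 0 3 (by decide) (by decide)
    · exact h' 0 2 1 2 (by decide) (by decide)
    · exact h' 0 2 1 3 (by decide) (by decide)
    · exact h' 0 2 2 3 (by decide) (by decide)
    · exact h' 1 2 0 1 (by decide) (by decide)
    · exact h' 1 2 0 2 (by decide) (by decide)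
    · exact h' 1 2 0 3 (by decide) (by decide)
    · exact h' 1 2 1 2 (by decide) (by decide)
    · exact h' 1 2 1 3 (by decide) (by decide)
    · exact h' 1 2 2 3 (by decide) (by decide)
  have main : ∀ k t, t + k = N → ∃ M ∈ reach, ∀ (i : Fin 3) (j : Fin 4),
      cellBit M i j = decide (t ≤ f i j) := by
    intro k
    induction k with
    | zero =>
      intro t ht
      refine ⟨0, by decide, fun i j => ?_⟩
      have := hN i j
      have h2 : ¬ t ≤ f i j := by omega
      simp [cellBit, h2]
    | succ k ih =>
      intro t ht
      obtain ⟨M, hM, h⟩ := ih (t + 1) (by omega)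
      by_cases hex : ∃ i j, f i j = t
      · obtain ⟨i, j, hij⟩ := hex
        have key : ∀ (k : Fin 3) (l : Fin 4),
            cellBit (M ||| 2 ^ (4 * i.1 + j.1)) k l = decide (t ≤ f k l) := by
          intro k l
          have hkl := h k l
          unfold cellBit at hkl ⊢
          rw [Nat.testBit_or, hkl, Nat.testBit_two_pow, ← Bool.decide_or]
          congr 1
          apply propext
          constructor
          · rintro (h1 | h1)
            · omega
            · have e1 : i = k := by ext; omega
              have e2 : j = l := by ext; omega
              subst e1 e2
              omega
          · intro h1
            by_cases h2 : t + 1 ≤ f k l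
            · exact Or.inl h2
            · obtain ⟨e1, e2⟩ := hinj i j k l (by omega)
              subst e1 e2
              exact Or.inr rfl
        exact ⟨_, reach_step M hM i j (ok t _ key), key⟩
      · refine ⟨M, hM, fun i j => ?_⟩
        rw [h i j]
        congr 1
        apply propext
        have : f i j ≠ t := fun e => hex ⟨i, j, e⟩
        omega
  obtain ⟨M, hM, h⟩ := main N 0 (by omega)
  obtain ⟨i, j, hij⟩ := reach_not_full M hM
  rw [h i j] at hij
  simp at hij

/-- For 3 ≤ m ≤ n with 4 ≤ n there is no universal σ: every σ admits a matrix A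
and a σ-arrangement of A that is not supmodular. -/
theorem no_universal (m n : ℕ) (hm : 3 ≤ m) (hmn : m ≤ n) (hn : 4 ≤ n)
    (σ : Matrix (Fin m) (Fin n) ℕ) (hperm : IsPermMatrix σ) :
    ∃ (A B : Matrix (Fin m) (Fin n) ℝ), IsArrangement σ A B ∧ ¬ Supmodular B := by
  by_contra hcon
  push Not at hcon
  have hs : ∀ t : ℕ, Supmodular
      (fun i j => (((decide (t ≤ σ i j)).toNat : ℕ) : ℝ) : Matrix (Fin m) (Fin n) ℝ) := by
    intro t
    apply hcon (fun i j => (((decide (t ≤ σ i j)).toNat : ℕ) : ℝ))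
    refine ⟨Equiv.refl _, fun p => rfl, fun p q hpq => ?_⟩
    apply Nat.cast_le.mpr
    by_cases h1 : t ≤ σ p.1 p.2
    · have h2 : t ≤ σ q.1 q.2 := by omega
      simp [h1, h2]
    · simp [h1]
  refine no_chain (fun i j => σ (Fin.castLE hm i) (Fin.castLE hn j)) ?_ ?_ (m * n + 1) ?_
  · intro i j k l h
    have := @hperm.1 (Fin.castLE hm i, Fin.castLE hn j) (Fin.castLE hm k, Fin.castLE hn l) h
    simpa [Prod.ext_iff, Fin.ext_iff] using this
  · intro t i r j s hi hj
    have := hs t (Fin.castLE hm i) (Fin.castLE hm r) (Fin.castLE hn j) (Fin.castLE hn s) hi hj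
    beta_reduce at this ⊢
    exact_mod_cast this
  · intro i j
    exact Nat.lt_succ_of_le (hperm.2 (Fin.castLE hm i, Fin.castLE hn j)).2
end

section
/- Every real 2×n matrix is permutable. -/
/-- Every real 2×n matrix is permutable. -/
theorem permutable_two_rows {n : ℕ} (A : Matrix (Fin 2) (Fin n) ℝ) :
    Permutable A := by
  -- sort the columns by the difference of their two entries
  refine ⟨Equiv.prodCongr (Equiv.refl _) (Tuple.sort fun j => A 1 j - A 0 j), ?_⟩
  intro i r j s hir hjs
  have h := Tuple.monotone_sort (fun j => A 1 j - A 0 j) hjs.le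
  obtain rfl : i = 0 := by omega
  obtain rfl : r = 1 := by omega
  simp only [Function.comp] at h
  simp only [Matrix.of_apply, Equiv.prodCongr_apply, Prod.map, Equiv.refl_apply]
  linarith
end

section
/- Every real 3×3 matrix is permutable. -/
/-- Every real 3×3 matrix is permutable. -/
theorem permutable_three_by_three (A : Matrix (Fin 3) (Fin 3) ℝ) :
    Permutable A := by
  let e : Fin 3 × Fin 3 ≃ Fin 9 := finProdFinEquiv
  let f : Fin 9 → ℝ := fun k => A (e.symm k).1 (e.symm k).2
  let ρ : Fin 9 ≃ Fin 9 :=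
    { toFun := ![6, 1, 0, 5, 4, 7, 2, 3, 8]
      invFun := ![2, 1, 6, 7, 4, 3, 0, 5, 8]
      left_inv := by decide
      right_inv := by decide }
  have hm : Monotone (f ∘ Tuple.sort f) := Tuple.monotone_sort f
  obtain ⟨g, hg⟩ : ∃ g : Fin 9 → ℝ, g = f ∘ Tuple.sort f := ⟨_, rfl⟩
  rw [← hg] at hm
  refine ⟨((e.trans ρ).trans (Tuple.sort f)).trans e.symm, ?_⟩
  have key : ∀ i j, A ((((e.trans ρ).trans (Tuple.sort f)).trans e.symm) (i, j)).1
      ((((e.trans ρ).trans (Tuple.sort f)).trans e.symm) (i, j)).2 = g (ρ (e (i, j))) := by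
    intro i j
    rw [hg]
    rfl
  have h00 : ρ (e (0, 0)) = 6 := by decide
  have h01 : ρ (e (0, 1)) = 1 := by decide
  have h02 : ρ (e (0, 2)) = 0 := by decide
  have h10 : ρ (e (1, 0)) = 5 := by decide
  have h11 : ρ (e (1, 1)) = 4 := by decide
  have h12 : ρ (e (1, 2)) = 7 := by decide
  have h20 : ρ (e (2, 0)) = 2 := by decide
  have h21 : ρ (e (2, 1)) = 3 := by decide
  have h22 : ρ (e (2, 2)) = 8 := by decide
  have m0 : g 0 ≤ g 1 := hm (by decide)
  have m1 : g 1 ≤ g 2 := hm (by decide)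
  have m2 : g 2 ≤ g 3 := hm (by decide)
  have m3 : g 3 ≤ g 4 := hm (by decide)
  have m4 : g 4 ≤ g 5 := hm (by decide)
  have m5 : g 5 ≤ g 6 := hm (by decide)
  have m6 : g 6 ≤ g 7 := hm (by decide)
  have m7 : g 7 ≤ g 8 := hm (by decide)
  intro i r j s hir hjs
  simp only [Matrix.of_apply, key]
  clear_value ρ e
  clear key hg hm
  fin_cases i <;> fin_cases r <;> first
    | exact absurd hir (by decide)
    | (fin_cases j <;> fin_cases s <;> first
        | exact absurd hjs (by decide)
        | (simp only [Fin.zero_eta, Fin.mk_one, Fin.reduceFinMk, h00, h01, h02, h10, h11, h12,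
            h20, h21, h22]
           linarith))
end

section
/- Every real 3×4 matrix is permutable. -/
/-- The six adjacent conditions imply supmodularity of a `3 × 4` matrix. -/
theorem supmodular_of_adjacent (B : Matrix (Fin 3) (Fin 4) ℝ)
    (h00 : B 0 0 + B 1 1 ≥ B 0 1 + B 1 0) (h01 : B 0 1 + B 1 2 ≥ B 0 2 + B 1 1)
    (h02 : B 0 2 + B 1 3 ≥ B 0 3 + B 1 2) (h10 : B 1 0 + B 2 1 ≥ B 1 1 + B 2 0)
    (h11 : B 1 1 + B 2 2 ≥ B 1 2 + B 2 1) (h12 : B 1 2 + B 2 3 ≥ B 1 3 + B 2 2) :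
    Supmodular B := by
  intro i r j s hir hjs
  fin_cases i <;> fin_cases r <;> first | (exact absurd hir (by decide)) | skip
  all_goals
    fin_cases j <;> fin_cases s <;> first | (exact absurd hjs (by decide)) | skip
  all_goals
    simp only [Fin.zero_eta, Fin.mk_one, Fin.reduceFinMk]
    linarith

/-- Positions (row-major) of the sorted entries in the first arrangement. -/
def arrOne : Fin 12 → Fin 12 := ![9, 8, 7, 4, 3, 2, 6, 5, 0, 1, 10, 11]

/-- Positions (row-major) of the sorted entries in the second arrangement. -/
def arrTwo : Fin 12 → Fin 12 := ![7, 4, 3, 2, 6, 5, 9, 8, 0, 1, 10, 11]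

theorem arrOne_bijective : Function.Bijective arrOne := by decide

theorem arrTwo_bijective : Function.Bijective arrTwo := by decide

/-- Either `a₃ + a₁₀ ≥ a₄ + a₉` (first arrangement) or the reverse (second arrangement). -/
theorem permutable_three_by_four (A : Matrix (Fin 3) (Fin 4) ℝ) :
    Permutable A := by
  let e : Fin 3 × Fin 4 ≃ Fin 12 := finProdFinEquiv
  let f : Fin 12 → ℝ := fun k => A (e.symm k).1 (e.symm k).2
  let s := Tuple.sort f
  have hmono : Monotone (f ∘ s) := Tuple.monotone_sort f
  obtain ⟨g, hg⟩ : ∃ g : Fin 12 → ℝ, g = f ∘ s := ⟨_, rfl⟩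
  rw [← hg] at hmono
  have key : ∀ (ρ : Fin 12 → Fin 12), Function.Bijective ρ →
      Supmodular (Matrix.of fun i j => g (ρ (e (i, j)))) → Permutable A := by
    intro ρ hρ h
    refine ⟨((e.trans (Equiv.ofBijective ρ hρ)).trans s).trans e.symm, ?_⟩
    subst hg
    exact h
  have m0 : g 0 ≤ g 1 := hmono (by decide)
  have m1 : g 1 ≤ g 2 := hmono (by decide)
  have m2 : g 2 ≤ g 3 := hmono (by decide)
  have m3 : g 3 ≤ g 4 := hmono (by decide)
  have m4 : g 4 ≤ g 5 := hmono (by decide)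
  have m5 : g 5 ≤ g 6 := hmono (by decide)
  have m6 : g 6 ≤ g 7 := hmono (by decide)
  have m7 : g 7 ≤ g 8 := hmono (by decide)
  have m8 : g 8 ≤ g 9 := hmono (by decide)
  have m9 : g 9 ≤ g 10 := hmono (by decide)
  have m10 : g 10 ≤ g 11 := hmono (by decide)
  rcases le_total (g 3 + g 8) (g 2 + g 9) with h | h
  · refine key arrOne arrOne_bijective (supmodular_of_adjacent _ ?_ ?_ ?_ ?_ ?_ ?_)
    · change g 9 + g 2 ≥ g 8 + g 3
      linarith
    · change g 8 + g 6 ≥ g 7 + g 2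
      linarith
    · change g 7 + g 5 ≥ g 4 + g 6
      linarith
    · change g 3 + g 1 ≥ g 2 + g 0
      linarith
    · change g 2 + g 10 ≥ g 6 + g 1
      linarith
    · change g 6 + g 11 ≥ g 5 + g 10
      linarith
  · refine key arrTwo arrTwo_bijective (supmodular_of_adjacent _ ?_ ?_ ?_ ?_ ?_ ?_)
    · change g 7 + g 5 ≥ g 4 + g 6
      linarith
    · change g 4 + g 9 ≥ g 3 + g 5
      linarith
    · change g 3 + g 8 ≥ g 2 + g 9
      linarith
    · change g 6 + g 1 ≥ g 5 + g 0
      linarith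
    · change g 5 + g 10 ≥ g 9 + g 1
      linarith
    · change g 9 + g 11 ≥ g 8 + g 10
      linarith
end

section
/- Let σ be the 3×3 matrix with rows (9,6,2), (3,5,4), (1,7,8). Then for every real 3×3 matrix A, every σ-arrangement of A is supmodular. -/
/-- For σ with rows (9,6,2), (3,5,4), (1,7,8), every σ-arrangement of any real
3×3 matrix is supmodular. -/
theorem arrangement_supmodular_three_by_three'
    (σ : Matrix (Fin 3) (Fin 3) ℕ) (hσ : σ = !![9, 6, 2; 3, 5, 4; 1, 7, 8])
    (A B : Matrix (Fin 3) (Fin 3) ℝ) (hB : IsArrangement σ A B) :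
    Supmodular B := by
  obtain ⟨π, -, h⟩ := hB
  subst hσ
  have h1 := h (2, 0) (0, 2) (by simp)
  have h2 := h (0, 2) (1, 0) (by simp)
  have h3 := h (1, 0) (1, 2) (by simp)
  have h4 := h (1, 2) (1, 1) (by simp)
  have h5 := h (1, 1) (0, 1) (by simp)
  have h6 := h (0, 1) (2, 1) (by simp)
  have h7 := h (2, 1) (2, 2) (by simp)
  have h8 := h (2, 2) (0, 0) (by simp)
  clear h
  dsimp only at h1 h2 h3 h4 h5 h6 h7 h8
  intro i r j s hir hjs
  fin_cases i <;> fin_cases r <;> first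
    | (exfalso; revert hir; decide)
    | (fin_cases j <;> fin_cases s <;> first
        | (exfalso; revert hjs; decide)
        | (simp only [Fin.zero_eta, Fin.mk_one, Fin.reduceFinMk]; linarith))
end
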